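/- arXiv:2401.03924 — 3 statements merged into one kernel-verified Lean document; each statement's English description precedes it below -/
import Mathlib

section
/- For every graph G and every t ≥ 1, the path-shortening property Pshort(t) implies the local modifier property L-Mod(4t²): for every red-blue coloring, every perfect matching M, and every M-alternating path P with an even number of edges, w_M(P) ≤ 0, and at least 4t² red edges, there exists an M-alternating cycle C with V(C) ⊆ V(P), C contains a non-matching edge of P, and -4t² ≤ w_M(C) ≤ 0. -/
variable {V : Type*} [Fintype V] [DecidableEq V]

/-- `M` is a perfect matching of `G`: every edge of `M` is an edge of `G`,
and every vertex lies in exactly one edge of `M`. -/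
def IsPM (G : SimpleGraph V) (M : Finset (Sym2 V)) : Prop :=
  (∀ e ∈ M, e ∈ G.edgeSet) ∧ ∀ v : V, ∃! e, e ∈ M ∧ v ∈ e

/-- The `M`-induced weight of an edge, for the coloring `c` (`true` = red):
`-1` for red matching edges, `+1` for red non-matching edges, `0` for blue edges. -/
def wt (c : Sym2 V → Bool) (M : Finset (Sym2 V)) (e : Sym2 V) : ℤ :=
  if c e then (if e ∈ M then -1 else 1) else 0

/-- Number of red edges of a finite edge set. -/
def redCount (c : Sym2 V → Bool) (F : Finset (Sym2 V)) : ℕ :=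
  (F.filter (fun e => c e = true)).card

/-- A walk is `M`-alternating if consecutive edges have opposite membership in `M`. -/
def IsAlt (M : Finset (Sym2 V)) {G : SimpleGraph V} {u v : V} (P : G.Walk u v) : Prop :=
  P.edges.Chain' (fun e f => (e ∈ M) ↔ f ∉ M)

/-- The path-shortening property `Pshort(t)`: for every perfect matching `M`, every
`M`-alternating path `P`, and every family of `t` matching edges `{a i, b i}` of `P`
whose endpoints appear along `P` in the order `a 1, b 1, …, a t, b t`, either
`G` has an edge `{a i, b j}` with `i < j`, or `G` has both edges `{a i1, a i3}` and
`{b i2, b i4}` for some `i1 < i2 < i3 < i4`. -/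
def Pshort (G : SimpleGraph V) (t : ℕ) : Prop :=
  ∀ (M : Finset (Sym2 V)), IsPM G M →
    ∀ (u v : V) (P : G.Walk u v), P.IsPath → IsAlt M P →
      ∀ a b : Fin t → V,
        (∀ i, s(a i, b i) ∈ M ∧ s(a i, b i) ∈ P.edges) →
        List.Sublist ((List.finRange t).flatMap (fun i => [a i, b i])) P.support →
        (∃ i j, i < j ∧ G.Adj (a i) (b j)) ∨
        (∃ i1 i2 i3 i4 : Fin t, i1 < i2 ∧ i2 < i3 ∧ i3 < i4 ∧
          G.Adj (a i1) (a i3) ∧ G.Adj (b i2) (b i4))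

/-- An `M`-alternating cycle: cyclically consecutive edges have opposite
membership in `M`. -/
def IsAltCycle {G : SimpleGraph V} (M : Finset (Sym2 V)) {x : V} (C : G.Walk x x) : Prop :=
  C.IsCycle ∧ C.edges.Chain' (fun e f => (e ∈ M) ↔ f ∉ M) ∧
    ∀ e f, C.edges.head? = some e → C.edges.getLast? = some f → ((f ∈ M) ↔ e ∉ M)

/-- An `(M,P)`-modifier: an `M`-alternating cycle on vertices of `P`
using at least one non-matching edge of `P`. -/
def IsModifier {G : SimpleGraph V} (M : Finset (Sym2 V)) {u v x : V}
    (P : G.Walk u v) (C : G.Walk x x) : Prop :=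
  IsAltCycle M C ∧ (∀ y ∈ C.support, y ∈ P.support) ∧ ∃ e ∈ C.edges, e ∈ P.edges ∧ e ∉ M

/-- The local modifier property `L-Mod(t)`: every `t`-good alternating path admits
a modifier of weight in `[-t, 0]`. -/
def LMod (G : SimpleGraph V) (t : ℕ) : Prop :=
  ∀ (c : Sym2 V → Bool) (M : Finset (Sym2 V)), IsPM G M →
    ∀ (u v : V) (P : G.Walk u v), P.IsPath → IsAlt M P →
      Even P.edges.length → (P.edges.map (wt c M)).sum ≤ 0 →
      t ≤ P.edges.countP (fun e => c e) →
      ∃ (x : V) (C : G.Walk x x), IsModifier M P C ∧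
        -(t : ℤ) ≤ (C.edges.map (wt c M)).sum ∧ (C.edges.map (wt c M)).sum ≤ 0

/-- The dual local modifier property `Dual-L-Mod(t)`: every dual-`t`-good
alternating path admits a modifier of weight in `[0, t]`. -/
def DualLMod (G : SimpleGraph V) (t : ℕ) : Prop :=
  ∀ (c : Sym2 V → Bool) (M : Finset (Sym2 V)), IsPM G M →
    ∀ (u v : V) (P : G.Walk u v), P.IsPath → IsAlt M P →
      Even P.edges.length → 0 ≤ (P.edges.map (wt c M)).sum →
      t ≤ P.edges.countP (fun e => !c e) →
      ∃ (x : V) (C : G.Walk x x), IsModifier M P C ∧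
        0 ≤ (C.edges.map (wt c M)).sum ∧ (C.edges.map (wt c M)).sum ≤ (t : ℤ)

/-- The `k`-th edge of a walk (meaningful for `k < P.length`). -/
def walkEdge {G : SimpleGraph V} {u v : V} (P : G.Walk u v) (k : ℕ) : Sym2 V :=
  s(P.getVert k, P.getVert (k + 1))

/-- The total `M`-induced weight of the first `k` edges of a walk. -/
def prefixWt (c : Sym2 V → Bool) (M : Finset (Sym2 V)) {G : SimpleGraph V} {u v : V}
    (P : G.Walk u v) (k : ℕ) : ℤ :=
  ∑ i ∈ Finset.range k, wt c M (walkEdge P i)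

/-- If an integer sequence with steps of size at most one drops by at least `t`, then it has `t`
unit down-steps at successive levels. -/
lemma exists_descent_of_drop (f : ℕ → ℤ) (n t : ℕ) (ht : 1 ≤ t)
    (step : ∀ k < n, f k - 1 ≤ f (k + 1)) {p q : ℕ} (hpq : p ≤ q) (hq : q ≤ n)
    (hdrop : f q + t ≤ f p) :
    ∃ g : Fin t → ℕ, StrictMono g ∧ (∀ i, g i < n ∧ f (g i + 1) = f (g i) - 1) ∧
      ∀ i j, i < j → f (g j) ≤ f (g i) ∧ f (g i) ≤ f (g j) + t - 1 := by
  have hpq' : p < q := by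
    rcases hpq.lt_or_eq with h | rfl
    · exact h
    · omega
  have ex : ∀ m : Fin t, ∃ k, p ≤ k ∧ f (k + 1) ≤ f p - m - 1 := fun m =>
    ⟨q - 1, by omega, by
      have := m.2
      rw [Nat.sub_add_cancel (by omega)]
      omega⟩
  have hlt : ∀ m, Nat.find (ex m) < n := fun m => by
    have : Nat.find (ex m) ≤ q - 1 := Nat.find_min' _ ⟨by omega, by
      have := m.2
      rw [Nat.sub_add_cancel (by omega)]
      omega⟩
    omega
  have hval : ∀ m, f (Nat.find (ex m)) = f p - m ∧ f (Nat.find (ex m) + 1) = f p - m - 1 := by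
    intro m
    obtain ⟨h1, h2⟩ := Nat.find_spec (ex m)
    have h3 := step _ (hlt m)
    have h4 : f p - m ≤ f (Nat.find (ex m)) := by
      rcases h1.lt_or_eq with h | h
      · have := Nat.find_min (ex m) (m := Nat.find (ex m) - 1) (by omega)
        rw [Nat.sub_add_cancel (by omega)] at this
        by_contra hc
        exact this ⟨by omega, by omega⟩
      · rw [← h]; omega
    omega
  refine ⟨fun m => Nat.find (ex m), ?_, fun i => ⟨hlt i, ?_⟩, fun i j hij => ?_⟩
  · intro i j hij
    have hij' : (i : ℕ) < j := hij
    have hle : Nat.find (ex i) ≤ Nat.find (ex j) := Nat.find_min' _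
      ⟨(Nat.find_spec (ex j)).1, by have := (hval j).2; omega⟩
    refine lt_of_le_of_ne hle fun heq => ?_
    have h1 := (hval i).1
    have h2 := (hval j).1
    dsimp only at heq
    rw [heq] at h1
    omega
  · have := hval i
    dsimp only
    omega
  · have hij' : (i : ℕ) < j := hij
    have := hval i
    have := hval j
    have := j.2
    dsimp only
    omega

/-- An integer sequence with steps of size at most one that starts at `0`, ends at or below `0` and
has at least `2 * t ^ 2` unit down-steps has `t` of them at weakly descending levels within a window
of size `t`. -/
lemma exists_descent (f : ℕ → ℤ) (n t : ℕ) (ht : 1 ≤ t)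
    (step : ∀ k < n, f k - 1 ≤ f (k + 1)) (h0 : f 0 = 0) (hn : f n ≤ 0)
    (hc : 2 * t ^ 2 ≤ ((Finset.range n).filter (fun k => f (k + 1) = f k - 1)).card) :
    ∃ g : Fin t → ℕ, StrictMono g ∧ (∀ i, g i < n ∧ f (g i + 1) = f (g i) - 1) ∧
      ∀ i j, i < j → f (g j) ≤ f (g i) ∧ f (g i) ≤ f (g j) + t - 1 := by
  by_cases hdrop : ∃ p q, p ≤ q ∧ q ≤ n ∧ f q + t ≤ f p
  · obtain ⟨p, q, hpq, hq, hd⟩ := hdrop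
    exact exists_descent_of_drop f n t ht step hpq hq hd
  push Not at hdrop
  have maps : ∀ k ∈ (Finset.range n).filter (fun k => f (k + 1) = f k - 1),
      f k ∈ Finset.Ioo (-(t : ℤ)) t := by
    intro k hk
    have hk' : k < n := by simpa using (Finset.mem_filter.1 hk).1
    have h1 := hdrop 0 k (by omega) hk'.le
    have h2 := hdrop k n hk'.le le_rfl
    rw [Finset.mem_Ioo]
    omega
  obtain ⟨y, -, hy⟩ := Finset.exists_le_card_fiber_of_mul_le_card_of_maps_to (n := t) maps
    ⟨0, by rw [Finset.mem_Ioo]; omega⟩ (le_trans (by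
      have h1 : (Finset.Ioo (-(t : ℤ)) t).card ≤ 2 * t := by
        rw [Int.card_Ioo]
        omega
      nlinarith) hc)
  have hmem := Finset.orderEmbOfCardLe_mem _ hy
  simp only [Finset.mem_filter, Finset.mem_range] at hmem
  refine ⟨Finset.orderEmbOfCardLe _ hy, OrderEmbedding.strictMono _,
    fun i => (hmem i).1, fun i j _ => ?_⟩
  rw [(hmem i).2, (hmem j).2]
  omega

section Walks

variable {G : SimpleGraph V} {u v : V} {M : Finset (Sym2 V)}

omit [Fintype V] [DecidableEq V] in
lemma exists_subwalk (P : G.Walk u v) (d : ℕ) : ∀ i j, j = i + d → j ≤ P.length →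
    ∃ Q : G.Walk (P.getVert i) (P.getVert j),
      Q.support = (List.range' i (d + 1)).map P.getVert ∧
      Q.edges = (List.range' i d).map (walkEdge P) := by
  induction d with
  | zero =>
    rintro i _ rfl -
    exact ⟨.nil, by simp, by simp⟩
  | succ d ih =>
    intro i j hj hjn
    obtain ⟨Q, h1, h2⟩ := ih (i + 1) j (by omega) hjn
    refine ⟨.cons (P.adj_getVert_succ (by omega)) Q, ?_, ?_⟩
    · rw [SimpleGraph.Walk.support_cons, h1, List.range'_succ (n := d + 1)]
      rfl
    · rw [SimpleGraph.Walk.edges_cons, h2, List.range'_succ]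
      rfl

omit [Fintype V] [DecidableEq V] in
lemma support_eq_map_getVert (P : G.Walk u v) :
    P.support = (List.range (P.length + 1)).map P.getVert := by
  apply List.ext_getElem
  · simp
  · intro k h1 h2
    simp [P.support_getElem_eq_getVert]

omit [Fintype V] [DecidableEq V] in
lemma edges_eq_map_walkEdge (P : G.Walk u v) :
    P.edges = (List.range P.length).map (walkEdge P) := by
  induction P with
  | nil => rfl
  | cons h p ih =>
    rw [SimpleGraph.Walk.edges_cons, ih, SimpleGraph.Walk.length_cons, List.range_succ_eq_map]
    simp [walkEdge]

omit [Fintype V] [DecidableEq V] in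
lemma IsAlt.walkEdge_iff {P : G.Walk u v} (hA : IsAlt M P) {k : ℕ} (hk : k + 1 < P.length) :
    walkEdge P k ∈ M ↔ walkEdge P (k + 1) ∉ M := by
  unfold IsAlt at hA
  rw [edges_eq_map_walkEdge] at hA
  have := List.isChain_iff_getElem.1 hA k (by simpa using hk)
  simpa using this

omit [Fintype V] in
lemma prefixWt_eq_sub (c : Sym2 V → Bool) (P : G.Walk u v) (i d : ℕ) :
    (((List.range' i d).map (walkEdge P)).map (wt c M)).sum =
      prefixWt c M P (i + d) - prefixWt c M P i := by
  induction d with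
  | zero => simp
  | succ d ih =>
    rw [List.range'_concat, List.map_append, List.map_append, List.sum_append, ih,
      ← add_assoc, prefixWt, prefixWt, prefixWt, Finset.sum_range_succ]
    simp
    ring

omit [Fintype V] in
lemma countP_red_eq (c : Sym2 V → Bool) (P : G.Walk u v) (n : ℕ) :
    ((((List.range n).map (walkEdge P)).countP (fun e => c e) : ℕ) : ℤ) = prefixWt c M P n +
      2 * ((Finset.range n).filter (fun k => prefixWt c M P (k + 1) = prefixWt c M P k - 1)).card
      := by
  induction n with
  | zero => simp [show prefixWt c M P 0 = 0 from rfl]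
  | succ n ih =>
    have hs : prefixWt c M P (n + 1) = prefixWt c M P n + wt c M (walkEdge P n) :=
      Finset.sum_range_succ _ _
    rw [List.range_succ, List.map_append, List.countP_append, Nat.cast_add, ih,
      Finset.range_add_one, Finset.filter_insert]
    have hw : wt c M (walkEdge P n) =
        if c (walkEdge P n) then (if walkEdge P n ∈ M then -1 else 1) else 0 := rfl
    split_ifs with h
    · rw [Finset.card_insert_of_notMem (by simp)]
      by_cases h1 : c (walkEdge P n) <;> by_cases h2 : walkEdge P n ∈ M <;>
        simp [h1, h2] at hw ⊢ <;> omega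
    · by_cases h1 : c (walkEdge P n) <;> by_cases h2 : walkEdge P n ∈ M <;>
        simp [h1, h2] at hw ⊢ <;> omega

omit [Fintype V] in
/-- The part of an alternating path between two matching edges of the path, both included. -/
lemma exists_segment (c : Sym2 V → Bool) {P : G.Walk u v} (hP : P.IsPath) (hA : IsAlt M P)
    {i j : ℕ} (hij : i < j) (hj : j < P.length) (hi : walkEdge P i ∈ M) (hjM : walkEdge P j ∈ M) :
    ∃ Q : G.Walk (P.getVert i) (P.getVert (j + 1)), Q.IsPath ∧ 2 ≤ Q.length ∧
      IsAlt M Q ∧ (∀ e ∈ Q.edges.head?, e ∈ M) ∧ (∀ e ∈ Q.edges.getLast?, e ∈ M) ∧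
      (∀ x, x ∈ Q.support ↔ ∃ k, i ≤ k ∧ k ≤ j + 1 ∧ P.getVert k = x) ∧
      (∃ e ∈ Q.edges, e ∈ P.edges ∧ e ∉ M) ∧
      (Q.edges.map (wt c M)).sum = prefixWt c M P (j + 1) - prefixWt c M P i := by
  obtain ⟨Q, hs, he⟩ := exists_subwalk P (j + 1 - i) i (j + 1) (by omega) (by omega)
  refine ⟨Q, ?_, ?_, ?_, ?_, ?_, ?_, ?_, ?_⟩
  · rw [SimpleGraph.Walk.isPath_def, hs]
    refine List.Nodup.map_on (fun a ha b hb hab => ?_) List.nodup_range'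
    rw [List.mem_range'_1] at ha hb
    exact hP.getVert_injOn (by simp; omega) (by simp; omega) hab
  · rw [← SimpleGraph.Walk.length_edges, he]
    simp
    omega
  · unfold IsAlt
    rw [he]
    refine List.isChain_iff_getElem.2 fun k hk => ?_
    simp only [List.length_map, List.length_range'] at hk
    have := hA.walkEdge_iff (k := i + k) (by omega)
    simpa [add_assoc] using this
  · rw [he, show j + 1 - i = (j - i) + 1 by omega, List.range'_succ]
    simpa using hi
  · rw [he, show j + 1 - i = (j - i) + 1 by omega, List.range'_concat]
    simpa [show i + (j - i) = j by omega] using hjM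
  · intro x
    rw [hs]
    simp only [List.mem_map, List.mem_range'_1]
    constructor
    · rintro ⟨k, hk, rfl⟩
      exact ⟨k, by omega, by omega, rfl⟩
    · rintro ⟨k, h1, h2, rfl⟩
      exact ⟨k, by omega, rfl⟩
  · refine ⟨walkEdge P (i + 1), ?_, ?_, ?_⟩
    · rw [he]
      exact List.mem_map_of_mem (by rw [List.mem_range'_1]; omega)
    · rw [edges_eq_map_walkEdge]
      exact List.mem_map_of_mem (by rw [List.mem_range]; omega)
    · exact (hA.walkEdge_iff (by omega)).1 hi
  · rw [he, prefixWt_eq_sub, show i + (j + 1 - i) = j + 1 by omega]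

omit [Fintype V] [DecidableEq V] in
/-- Closing an alternating path that starts and ends with matching edges by a non-matching edge
gives an alternating cycle. -/
lemma isAltCycle_cons {x y : V} {Q : G.Walk x y} (hQ : Q.IsPath) (hl : 2 ≤ Q.length)
    (hA : IsAlt M Q) (hh : ∀ e ∈ Q.edges.head?, e ∈ M) (hlast : ∀ e ∈ Q.edges.getLast?, e ∈ M)
    (hadj : G.Adj y x) (hM : s(y, x) ∉ M) : IsAltCycle M (SimpleGraph.Walk.cons hadj Q) := by
  refine ⟨?_, ?_, ?_⟩
  · rw [SimpleGraph.Walk.cons_isCycle_iff]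
    refine ⟨hQ, fun h => ?_⟩
    rw [Sym2.eq_swap] at h
    have := hQ.length_eq_one_of_mem_edges h
    omega
  · exact List.isChain_cons.2 ⟨fun e he => by simp [hM, hh e he], hA⟩
  · intro e f he hf
    rw [SimpleGraph.Walk.edges_cons] at he hf
    have hne : Q.edges ≠ [] := by
      rw [← List.length_pos_iff, SimpleGraph.Walk.length_edges]
      omega
    rw [List.head?_cons, Option.some_inj] at he
    rw [List.getLast?_cons, Option.some_inj] at hf
    have : f ∈ M := hlast f (by
      rw [List.getLast?_eq_some_getLast hne] at hf ⊢
      simpa using hf)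
    simp [← he, hM, this]

omit [Fintype V] [DecidableEq V] in
/-- Joining two alternating paths that start and end with matching edges by a non-matching edge. -/
lemma isAlt_append_cons {x y z w : V} {Q : G.Walk x y} {R : G.Walk z w}
    (hQ : IsAlt M Q) (hR : IsAlt M R) (hlast : ∀ e ∈ Q.edges.getLast?, e ∈ M)
    (hh : ∀ e ∈ R.edges.head?, e ∈ M) (hadj : G.Adj y z) (hM : s(y, z) ∉ M) :
    IsAlt M (Q.append (.cons hadj R)) := by
  unfold IsAlt
  rw [SimpleGraph.Walk.edges_append, SimpleGraph.Walk.edges_cons]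
  refine List.isChain_append.2 ⟨hQ, List.isChain_cons.2 ⟨fun e he => by simp [hM, hh e he], hR⟩, ?_⟩
  intro e he f hf
  rw [List.head?_cons, Option.mem_some_iff] at hf
  simp [← hf, hM, hlast e he]

omit [Fintype V] [DecidableEq V] in
lemma IsAlt.reverse {x y : V} {Q : G.Walk x y} (hQ : IsAlt M Q) : IsAlt M Q.reverse := by
  unfold IsAlt
  rw [SimpleGraph.Walk.edges_reverse]
  refine List.isChain_reverse.2 (List.IsChain.imp (fun a b h => ?_) hQ)
  tauto

omit [Fintype V] [DecidableEq V] in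
lemma IsPM.eq_of_mem (hM : IsPM G M) {x y z : V} (h1 : s(x, y) ∈ M)
    (h2 : s(x, z) ∈ M) : y = z := by
  have := (hM.2 x).unique ⟨h1, by simp⟩ ⟨h2, by simp⟩
  exact Sym2.congr_right.1 this

omit [Fintype V] in
lemma wt_of_notMem (c : Sym2 V → Bool) {e : Sym2 V} (he : e ∉ M) :
    0 ≤ wt c M e ∧ wt c M e ≤ 1 := by
  unfold wt
  split_ifs <;> simp

omit [Fintype V] in
/-- A chord from the first vertex of a matching edge of the path to the last vertex of a later one
yields a modifier. -/
lemma exists_modifier_of_adj (c : Sym2 V → Bool) (hM : IsPM G M) {P : G.Walk u v}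
    (hP : P.IsPath) (hA : IsAlt M P) {i j : ℕ} (hij : i < j) (hj : j < P.length)
    (hi : walkEdge P i ∈ M) (hjM : walkEdge P j ∈ M)
    (hadj : G.Adj (P.getVert i) (P.getVert (j + 1))) :
    ∃ (x : V) (C : G.Walk x x), IsModifier M P C ∧
      prefixWt c M P (j + 1) - prefixWt c M P i ≤ (C.edges.map (wt c M)).sum ∧
      (C.edges.map (wt c M)).sum ≤ prefixWt c M P (j + 1) - prefixWt c M P i + 1 := by
  obtain ⟨Q, hQ, hl, hQA, hh, hlast, hs, ⟨e, heQ, heP, heM⟩, hw⟩ :=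
    exists_segment c hP hA hij hj hi hjM
  have hnew : s(P.getVert (j + 1), P.getVert i) ∉ M := fun h => by
    rw [Sym2.eq_swap] at h
    have := hP.getVert_injOn (by simp; omega) (by simp; omega) (hM.eq_of_mem hi h)
    omega
  refine ⟨_, .cons hadj.symm Q,
    ⟨isAltCycle_cons hQ hl hQA hh hlast hadj.symm hnew, ?_, e, by simp [heQ], heP, heM⟩, ?_⟩
  · intro y hy
    rw [SimpleGraph.Walk.support_cons, List.mem_cons] at hy
    rcases hy with rfl | hy
    · exact P.getVert_mem_support _
    · obtain ⟨k, -, -, rfl⟩ := (hs y).1 hy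
      exact P.getVert_mem_support _
  · have := wt_of_notMem c hnew
    rw [SimpleGraph.Walk.edges_cons, List.map_cons, List.sum_cons, hw]
    omega

omit [Fintype V] in
/-- Two crossing chords, one between first vertices and one between last vertices of matching edges
of the path, yield a modifier. -/
lemma exists_modifier_of_adj_of_adj (c : Sym2 V → Bool) (hM : IsPM G M) {P : G.Walk u v}
    (hP : P.IsPath) (hA : IsAlt M P) {i j k l : ℕ} (hij : i < j) (hjk : j + 1 < k) (hkl : k < l)
    (hl : l < P.length) (hi : walkEdge P i ∈ M) (hj : walkEdge P j ∈ M) (hk : walkEdge P k ∈ M)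
    (hlM : walkEdge P l ∈ M) (hadj : G.Adj (P.getVert i) (P.getVert k))
    (hadj' : G.Adj (P.getVert (j + 1)) (P.getVert (l + 1))) :
    ∃ (x : V) (C : G.Walk x x), IsModifier M P C ∧
      prefixWt c M P (j + 1) - prefixWt c M P i + (prefixWt c M P (l + 1) - prefixWt c M P k) ≤
        (C.edges.map (wt c M)).sum ∧
      (C.edges.map (wt c M)).sum ≤
        prefixWt c M P (j + 1) - prefixWt c M P i +
          (prefixWt c M P (l + 1) - prefixWt c M P k) + 2 := by
  obtain ⟨Q, hQ, hQl, hQA, hQh, hQlast, hQs, ⟨e, heQ, heP, heM⟩, hQw⟩ :=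
    exists_segment c hP hA hij (by omega) hi hj
  obtain ⟨R, hR, hRl, hRA, hRh, hRlast, hRs, -, hRw⟩ :=
    exists_segment c hP hA hkl hl hk hlM
  have inj : ∀ a b, a ≤ P.length → b ≤ P.length → P.getVert a = P.getVert b → a = b :=
    fun a b ha hb hab => hP.getVert_injOn (by simpa using ha) (by simpa using hb) hab
  have hnew : s(P.getVert k, P.getVert i) ∉ M := fun h => by
    rw [Sym2.eq_swap] at h
    have := inj _ _ (by omega) (by omega) (hM.eq_of_mem hi h)
    omega
  have hnew' : s(P.getVert (j + 1), P.getVert (l + 1)) ∉ M := fun h => by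
    have hj' := hj
    rw [walkEdge, Sym2.eq_swap] at hj'
    have := inj _ _ (by omega) (by omega) (hM.eq_of_mem hj' h)
    omega
  have hS : (Q.append (.cons hadj' R.reverse)).IsPath := by
    rw [SimpleGraph.Walk.isPath_def, SimpleGraph.Walk.support_append,
      SimpleGraph.Walk.support_cons, List.tail_cons, SimpleGraph.Walk.support_reverse,
      List.nodup_append']
    refine ⟨hQ.support_nodup, List.nodup_reverse.2 hR.support_nodup, fun x hx hx' => ?_⟩
    obtain ⟨a, ha, ha', rfl⟩ := (hQs x).1 hx
    obtain ⟨b, hb, hb', hab⟩ := (hRs _).1 (List.mem_reverse.1 hx')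
    have := inj _ _ (by omega) (by omega) hab
    omega
  have hSA : IsAlt M (Q.append (.cons hadj' R.reverse)) :=
    isAlt_append_cons hQA hRA.reverse hQlast (by simpa using hRlast) hadj' hnew'
  have hQne : Q.edges ≠ [] := by
    rw [← List.length_pos_iff, SimpleGraph.Walk.length_edges]
    omega
  have hRne : R.edges ≠ [] := by
    rw [← List.length_pos_iff, SimpleGraph.Walk.length_edges]
    omega
  refine ⟨_, .cons hadj.symm (Q.append (.cons hadj' R.reverse)),
    ⟨isAltCycle_cons hS ?_ hSA ?_ ?_ hadj.symm hnew, ?_, e, by simp [heQ], heP, heM⟩, ?_⟩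
  · rw [SimpleGraph.Walk.length_append]
    omega
  · rw [SimpleGraph.Walk.edges_append, List.head?_append_of_ne_nil _ hQne]
    exact hQh
  · rw [SimpleGraph.Walk.edges_append, SimpleGraph.Walk.edges_cons,
      SimpleGraph.Walk.edges_reverse, List.getLast?_append_of_ne_nil _ (by simp),
      List.getLast?_cons, List.getLast?_reverse, List.head?_eq_some_head hRne]
    simpa [List.head?_eq_some_head hRne] using hRh
  · intro y hy
    simp only [SimpleGraph.Walk.support_cons, SimpleGraph.Walk.support_append, List.mem_cons,
      List.tail_cons, List.mem_append, SimpleGraph.Walk.support_reverse, List.mem_reverse] at hy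
    rcases hy with rfl | hy | hy
    · exact P.getVert_mem_support _
    · obtain ⟨k, -, -, rfl⟩ := (hQs y).1 hy
      exact P.getVert_mem_support _
    · obtain ⟨k, -, -, rfl⟩ := (hRs y).1 hy
      exact P.getVert_mem_support _
  · have h1 := wt_of_notMem c hnew
    have h2 := wt_of_notMem c hnew'
    simp only [SimpleGraph.Walk.edges_cons, SimpleGraph.Walk.edges_append,
      SimpleGraph.Walk.edges_reverse, List.map_cons, List.map_append, List.map_reverse,
      List.sum_cons, List.sum_append, List.sum_reverse, hQw, hRw]
    omega

end Walks

/-- For non-overlapping pairs of consecutive positions, the list of these positions is a sublist of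
the list of all positions. -/
lemma flatMap_sublist_range {t n : ℕ} (g : Fin t → ℕ) (hg : ∀ i j, i < j → g i + 1 < g j)
    (hn : ∀ i, g i + 1 < n) :
    ((List.finRange t).flatMap (fun i => [g i, g i + 1])).Sublist (List.range n) := by
  have hsort : ((List.finRange t).flatMap (fun i => [g i, g i + 1])).Pairwise (· < ·) := by
    rw [List.pairwise_flatMap]
    refine ⟨by simp, (List.pairwise_lt_finRange t).imp fun {i j} hij => ?_⟩
    have := hg i j hij
    simp
    omega
  refine List.sublist_of_subperm_of_pairwise (List.subperm_of_subset ?_ ?_) hsort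
    List.pairwise_lt_range
  · exact hsort.imp fun h => h.ne
  · intro x hx
    obtain ⟨i, -, hi⟩ := List.mem_flatMap.1 hx
    have := hn i
    simp only [List.mem_cons, List.not_mem_nil, or_false] at hi
    rw [List.mem_range]
    omega

/-- for every graph `G` and every `t ≥ 1`, the path-shortening
property `Pshort(t)` implies the local modifier property `L-Mod(4t²)`. -/
theorem stmt_10 (G : SimpleGraph V) (t : ℕ) (ht : 1 ≤ t) (h : Pshort G t) :
    LMod G (4 * t ^ 2) := by
  intro c M hM u v P hP hA _ hw hred
  have hwt : ∀ e, -1 ≤ wt c M e ∧ (wt c M e = -1 → e ∈ M) := by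
    intro e
    unfold wt
    split_ifs <;> simp_all
  have hsucc : ∀ k, prefixWt c M P (k + 1) = prefixWt c M P k + wt c M (walkEdge P k) :=
    fun k => Finset.sum_range_succ _ _
  have hn : prefixWt c M P P.length ≤ 0 := by
    have := prefixWt_eq_sub (M := M) c P 0 P.length
    rw [← List.range_eq_range', ← edges_eq_map_walkEdge] at this
    simp only [zero_add] at this
    have h0 : prefixWt c M P 0 = 0 := rfl
    omega
  have hcount := countP_red_eq (M := M) c P P.length
  rw [← edges_eq_map_walkEdge] at hcount
  obtain ⟨g, hg, hgn, hgw⟩ := exists_descent (prefixWt c M P) P.length t ht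
    (fun k _ => by have := (hwt (walkEdge P k)).1; rw [hsucc]; omega) rfl hn (by omega)
  have hgM : ∀ i, walkEdge P (g i) ∈ M := fun i =>
    (hwt _).2 (by have := (hgn i).2; rw [hsucc] at this; omega)
  have hgap : ∀ i j, i < j → g i + 1 < g j := by
    intro i j hij
    have h1 : g i < g j := hg hij
    refine lt_of_le_of_ne h1 fun heq => ?_
    have h2 := (hA.walkEdge_iff (k := g i) (heq ▸ (hgn j).1)).1 (hgM i)
    exact h2 (heq ▸ hgM j)
  have htt : t ≤ t ^ 2 := Nat.le_self_pow (by norm_num) t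
  have htt' : ((4 * t ^ 2 : ℕ) : ℤ) ≥ 4 * t := by omega
  rcases h M hM u v P hP hA (fun i => P.getVert (g i)) (fun i => P.getVert (g i + 1))
    (fun i => ⟨hgM i, by
      rw [edges_eq_map_walkEdge]
      exact List.mem_map.2 ⟨g i, List.mem_range.2 (hgn i).1, rfl⟩⟩)
    (by
      rw [support_eq_map_getVert]
      have := (flatMap_sublist_range g hgap (n := P.length + 1)
        (fun i => by have := (hgn i).1; omega)).map P.getVert
      simpa [List.map_flatMap] using this) with
    ⟨i, j, hij, hadj⟩ | ⟨i, j, k, l, hij, hjk, hkl, hadj, hadj'⟩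
  · obtain ⟨x, C, hC, h1, h2⟩ := exists_modifier_of_adj c hM hP hA (hg hij) (hgn j).1
      (hgM i) (hgM j) hadj
    have h3 := hgw i j hij
    have h4 := (hgn j).2
    exact ⟨x, C, hC, by omega, by omega⟩
  · obtain ⟨x, C, hC, h1, h2⟩ := exists_modifier_of_adj_of_adj c hM hP hA (hg hij)
      (hgap j k hjk) (hg hkl) (hgn l).1 (hgM i) (hgM j) (hgM k) (hgM l) hadj hadj'
    have h3 := hgw i j hij
    have h4 := (hgn j).2
    have h5 := hgw k l hkl
    have h6 := (hgn l).2
    exact ⟨x, C, hC, by omega, by omega⟩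
end

section
/- Let G be a graph with perfect matchings M and M', let C be a cycle in M △ M', and let C' and C'' be two vertex-disjoint M-alternating simple modifiers of C. Define M_1 = M △ C', M_2 = M △ C'', and M_3 = M △ C' △ C''. Then for each i ∈ {1,2,3}, M_i is a perfect matching and max{rank(M_i △ M), rank(M_i △ M')} < rank(M △ M'). -/
variable {V : Type*} [Fintype V] [DecidableEq V]

/-- `C` is a cycle of `G` all of whose edges lie in the edge set `D`. -/
def IsCycleIn (G : SimpleGraph V) (D : Finset (Sym2 V)) {x : V} (C : G.Walk x x) : Prop :=
  C.IsCycle ∧ ∀ e ∈ C.edges, e ∈ D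

/-- `C'` is an `N`-alternating simple modifier of the cycle `C`: an `N`-alternating
cycle whose edge set differs from that of `C` by exactly one edge, which is a chord
of `C` (both its endpoints lie on `C`). -/
def IsSimpleModifier {G : SimpleGraph V} (N : Finset (Sym2 V)) {x y : V}
    (C : G.Walk x x) (C' : G.Walk y y) : Prop :=
  IsAltCycle N C' ∧ ∃ e : Sym2 V, C'.edges.toFinset \ C.edges.toFinset = {e} ∧
    (∀ z ∈ e, z ∈ C.support)

/-- The number of cycles of the edge set `D` (e.g. a symmetric difference of two
perfect matchings): the number of connected components containing an edge of the
graph spanned by `D`. -/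
noncomputable def numCycles (D : Finset (Sym2 V)) : ℕ :=
  Nat.card {cc : (SimpleGraph.fromEdgeSet (↑D : Set (Sym2 V))).ConnectedComponent //
    ∃ u w, (SimpleGraph.fromEdgeSet (↑D : Set (Sym2 V))).Adj u w ∧
      (SimpleGraph.fromEdgeSet (↑D : Set (Sym2 V))).connectedComponentMk u = cc}

/-- The maximum number of pairwise (vertex-)disjoint `N`-alternating simple
modifiers with respect to cycles contained in `D`. -/
noncomputable def maxDisjSM (G : SimpleGraph V) (N D : Finset (Sym2 V)) : ℕ :=
  sSup {k : ℕ | ∃ (x y : Fin k → V) (C : ∀ i : Fin k, G.Walk (x i) (x i))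
      (C' : ∀ i : Fin k, G.Walk (y i) (y i)),
      (∀ i, IsCycleIn G D (C i) ∧ IsSimpleModifier N (C i) (C' i)) ∧
      (∀ i j, i ≠ j → ∀ z ∈ (C' i).support, z ∉ (C' j).support)}

/-- The rank of the symmetric difference of two perfect matchings `N, N'`. -/
noncomputable def rank (G : SimpleGraph V) (N N' : Finset (Sym2 V)) : ℝ :=
  ((symmDiff N N').card : ℝ) + 1 / (1 + (numCycles (symmDiff N N') : ℝ)) +
    1 / ((Fintype.card V : ℝ) *
      (1 + (max (maxDisjSM G N (symmDiff N N')) (maxDisjSM G N' (symmDiff N N')) : ℝ)))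

omit [Fintype V] [DecidableEq V] in
theorem mem_support_of_mem_edge {G : SimpleGraph V} {u v w : V} {p : G.Walk u v} {e : Sym2 V}
    (he : e ∈ p.edges) (hw : w ∈ e) : w ∈ p.support := by
  obtain ⟨t, rfl⟩ := hw
  exact p.fst_mem_support_of_mem_edges he

omit [Fintype V] [DecidableEq V] in
/-- Every vertex of a cycle lies on exactly two edges of the cycle. -/
theorem exists_two_edges_of_isCycle {G : SimpleGraph V} {x v : V} {C : G.Walk x x}
    (hC : C.IsCycle) (hv : v ∈ C.support) :
    ∃ f g : Sym2 V, f ≠ g ∧ ∀ h, (h ∈ C.edges ∧ v ∈ h) ↔ h = f ∨ h = g := by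
  obtain ⟨p, q, hpq, hN⟩ := Set.ncard_eq_two.mp (hC.ncard_neighborSet_toSubgraph_eq_two hv)
  have key : ∀ t, s(v, t) ∈ C.edges ↔ t = p ∨ t = q := by
    intro t
    have : t ∈ C.toSubgraph.neighborSet v ↔ t = p ∨ t = q := by rw [hN]; simp
    rw [← this, SimpleGraph.Subgraph.mem_neighborSet, ← SimpleGraph.Subgraph.mem_edgeSet,
      SimpleGraph.Walk.mem_edges_toSubgraph]
  refine ⟨s(v, p), s(v, q), fun h => hpq (Sym2.congr_right.mp h), fun h => ⟨?_, ?_⟩⟩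
  · rintro ⟨hh, t, rfl⟩
    rcases (key t).mp hh with rfl | rfl <;> simp
  · rintro (rfl | rfl)
    · exact ⟨(key _).mpr (Or.inl rfl), by simp⟩
    · exact ⟨(key _).mpr (Or.inr rfl), by simp⟩

omit [Fintype V] in
theorem card_edges_of_isCycle {G : SimpleGraph V} {x : V} {C : G.Walk x x} (hC : C.IsCycle) :
    C.edges.toFinset.card = C.length := by
  rw [List.toFinset_card_of_nodup hC.edges_nodup, C.length_edges]

omit [Fintype V] in
theorem card_support_of_isCycle {G : SimpleGraph V} {x : V} {C : G.Walk x x} (hC : C.IsCycle) :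
    C.support.toFinset.card = C.length := by
  have h : C.support.toFinset = C.support.tail.toFinset := by
    ext w
    rw [List.mem_toFinset, List.mem_toFinset, SimpleGraph.Walk.mem_support_iff]
    refine ⟨?_, Or.inr⟩
    rintro (rfl | h)
    · exact C.end_mem_tail_support hC.not_nil
    · exact h
  rw [h, List.toFinset_card_of_nodup hC.support_nodup]
  simp

omit [Fintype V] in
/-- Every vertex of an `M`-alternating cycle lies on an edge of the cycle that belongs to `M`. -/
theorem exists_matching_edge_of_isAltCycle {G : SimpleGraph V} {M : Finset (Sym2 V)} {x v : V}
    {C : G.Walk x x} (hC : IsAltCycle M C) (hv : v ∈ C.support) :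
    ∃ f ∈ C.edges, f ∈ M ∧ v ∈ f := by
  obtain ⟨hcyc, hchain, hends⟩ := hC
  have h3 := hcyc.three_le_length
  have hlen := C.length_edges
  have hends' : C.edges[C.length - 1]'(by omega) ∈ M ↔ C.edges[0]'(by omega) ∉ M := by
    refine hends _ _ ?_ ?_
    · rw [List.head?_eq_getElem?, List.getElem?_eq_getElem]
    · rw [List.getLast?_eq_getElem?]
      exact List.getElem?_eq_some_iff.mpr ⟨by omega, by simp only [hlen]⟩
  have hedge : ∀ i (hi : i < C.length), C.edges[i]'(by omega) =
      s(C.getVert i, C.getVert (i + 1)) := fun i hi => by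
    simp [SimpleGraph.Walk.getElem_edges_eq_edge_getElem_darts,
      SimpleGraph.Walk.darts_getElem_eq_getVert]
  have hchoose : ∀ i j (hi : i < C.length) (hj : j < C.length),
      (C.edges[i]'(by omega) ∈ M ↔ C.edges[j]'(by omega) ∉ M) →
      v ∈ C.edges[i]'(by omega) → v ∈ C.edges[j]'(by omega) →
      ∃ f ∈ C.edges, f ∈ M ∧ v ∈ f := by
    intro i j hi hj hij hvi hvj
    by_cases h : C.edges[j]'(by omega) ∈ M
    · exact ⟨_, List.getElem_mem _, h, hvj⟩
    · exact ⟨_, List.getElem_mem _, hij.mpr h, hvi⟩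
  obtain ⟨i, hi, hil⟩ := SimpleGraph.Walk.mem_support_iff_exists_getVert.mp hv
  by_cases h0 : i = 0 ∨ i = C.length
  · have hvx : v = x := by
      rcases h0 with rfl | rfl
      · simpa using hi.symm
      · simpa using hi.symm
    subst hvx
    refine hchoose (C.length - 1) 0 (by omega) (by omega) hends' ?_ ?_
    · rw [hedge _ (by omega), Nat.sub_add_cancel (by omega)]
      simp
    · rw [hedge _ (by omega)]
      simp
  · push Not at h0
    obtain ⟨j, rfl⟩ : ∃ j, i = j + 1 := ⟨i - 1, by omega⟩
    refine hchoose j (j + 1) (by omega) (by omega)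
      (List.isChain_iff_getElem.mp hchain j (by omega)) ?_ ?_
    · rw [hedge _ (by omega), hi]; simp
    · rw [hedge _ (by omega), hi]; simp

omit [Fintype V] [DecidableEq V] in
theorem IsPM.eq_of_mem_s11 {G : SimpleGraph V} {M : Finset (Sym2 V)} (hM : IsPM G M) {v : V}
    {e f : Sym2 V} (he : e ∈ M) (hve : v ∈ e) (hf : f ∈ M) (hvf : v ∈ f) : e = f :=
  (hM.2 v).unique ⟨he, hve⟩ ⟨hf, hvf⟩

omit [Fintype V] in
/-- Switching a perfect matching along a cycle that contains the matching edge of each of its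
vertices gives a perfect matching. -/
theorem IsPM.symmDiff_cycle {G : SimpleGraph V} {M : Finset (Sym2 V)} (hM : IsPM G M) {x : V}
    {C : G.Walk x x} (hC : C.IsCycle)
    (halt : ∀ v ∈ C.support, ∃ f ∈ C.edges, f ∈ M ∧ v ∈ f) :
    IsPM G (symmDiff M C.edges.toFinset) := by
  constructor
  · intro e he
    rcases Finset.mem_symmDiff.mp he with ⟨h, -⟩ | ⟨h, -⟩
    · exact hM.1 e h
    · exact C.edges_subset_edgeSet (List.mem_toFinset.mp h)
  · intro v
    by_cases hv : v ∈ C.support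
    · obtain ⟨f, hf, hfM, hvf⟩ := halt v hv
      obtain ⟨p, q, hpq, hall⟩ := exists_two_edges_of_isCycle hC hv
      obtain ⟨g, hgf, hall'⟩ : ∃ g, f ≠ g ∧ ∀ h, (h ∈ C.edges ∧ v ∈ h) ↔ h = f ∨ h = g := by
        rcases (hall f).mp ⟨hf, hvf⟩ with rfl | rfl
        · exact ⟨q, hpq, hall⟩
        · exact ⟨p, hpq.symm, fun h => (hall h).trans or_comm⟩
      obtain ⟨hg, hvg⟩ := (hall' g).mpr (Or.inr rfl)
      have hgM : g ∉ M := fun h => hgf (hM.eq_of_mem_s11 hfM hvf h hvg)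
      refine ⟨g, ⟨Finset.mem_symmDiff.mpr (Or.inr ⟨List.mem_toFinset.mpr hg, hgM⟩), hvg⟩, ?_⟩
      rintro h ⟨hh, hvh⟩
      rcases Finset.mem_symmDiff.mp hh with ⟨h1, h2⟩ | ⟨h1, h2⟩
      · exact absurd (List.mem_toFinset.mpr (hM.eq_of_mem_s11 hfM hvf h1 hvh ▸ hf)) h2
      · rcases (hall' h).mp ⟨List.mem_toFinset.mp h1, hvh⟩ with rfl | rfl
        · exact absurd hfM h2
        · rfl
    · obtain ⟨f, ⟨hf, hvf⟩, huniq⟩ := hM.2 v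
      have hout : ∀ h, v ∈ h → h ∉ C.edges.toFinset := fun h hvh hh =>
        hv (mem_support_of_mem_edge (List.mem_toFinset.mp hh) hvh)
      refine ⟨f, ⟨Finset.mem_symmDiff.mpr (Or.inl ⟨hf, hout f hvf⟩), hvf⟩, ?_⟩
      rintro h ⟨hh, hvh⟩
      rcases Finset.mem_symmDiff.mp hh with ⟨h1, -⟩ | ⟨h1, -⟩
      · exact huniq h ⟨h1, hvh⟩
      · exact absurd h1 (hout h hvh)

omit [Fintype V] in
/-- An edge of `M △ M'` with an endpoint on a cycle of `M △ M'` is an edge of that cycle. -/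
theorem IsCycleIn.mem_edges_of_mem_symmDiff {G : SimpleGraph V} {M M' : Finset (Sym2 V)}
    (hM : IsPM G M) (hM' : IsPM G M') {x : V} {C : G.Walk x x}
    (hC : IsCycleIn G (symmDiff M M') C) {v : V} (hv : v ∈ C.support) {e : Sym2 V}
    (he : e ∈ symmDiff M M') (hve : v ∈ e) : e ∈ C.edges := by
  obtain ⟨f, g, hfg, hall⟩ := exists_two_edges_of_isCycle hC.1 hv
  obtain ⟨hf, hvf⟩ := (hall f).mpr (Or.inl rfl)
  obtain ⟨hg, hvg⟩ := (hall g).mpr (Or.inr rfl)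
  have hfD := hC.2 f hf
  have hgD := hC.2 g hg
  rw [Finset.mem_symmDiff] at he hfD hgD
  have hor : e = f ∨ e = g := by
    rcases he with ⟨h1, -⟩ | ⟨h1, -⟩ <;> rcases hfD with ⟨h2, -⟩ | ⟨h2, -⟩ <;>
      rcases hgD with ⟨h3, -⟩ | ⟨h3, -⟩
    all_goals first
      | exact absurd (hM.eq_of_mem_s11 h2 hvf h3 hvg) hfg
      | exact absurd (hM'.eq_of_mem_s11 h2 hvf h3 hvg) hfg
      | exact Or.inl (hM.eq_of_mem_s11 h1 hve h2 hvf)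
      | exact Or.inl (hM'.eq_of_mem_s11 h1 hve h2 hvf)
      | exact Or.inr (hM.eq_of_mem_s11 h1 hve h3 hvg)
      | exact Or.inr (hM'.eq_of_mem_s11 h1 hve h3 hvg)
  rcases hor with rfl | rfl <;> assumption

omit [Fintype V] in
/-- A simple modifier of a cycle of `M △ M'` has exactly one edge outside `M △ M'`, and all of
its vertices lie on the cycle. -/
theorem IsSimpleModifier.exists_chord {G : SimpleGraph V} {M M' N : Finset (Sym2 V)}
    (hM : IsPM G M) (hM' : IsPM G M') {x y : V} {C : G.Walk x x}
    (hC : IsCycleIn G (symmDiff M M') C) {C' : G.Walk y y} (h : IsSimpleModifier N C C') :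
    (∃ e ∈ C'.edges.toFinset, e ∉ symmDiff M M' ∧
      ∀ f ∈ C'.edges.toFinset, f ≠ e → f ∈ symmDiff M M') ∧
    C'.support.toFinset ⊆ C.support.toFinset := by
  obtain ⟨halt, e, he, hends⟩ := h
  have hmem : ∀ f, (f ∈ C'.edges ∧ f ∉ C.edges) ↔ f = e := fun f => by
    simpa using (Finset.ext_iff.mp he f)
  obtain ⟨he', heC⟩ := (hmem e).mpr rfl
  have hin : ∀ f ∈ C'.edges, f ≠ e → f ∈ C.edges := fun f hf hfe => by
    by_contra hcon
    exact hfe ((hmem f).mp ⟨hf, hcon⟩)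
  refine ⟨⟨e, List.mem_toFinset.mpr he', fun heD => ?_, fun f hf hfe =>
    hC.2 f (hin f (List.mem_toFinset.mp hf) hfe)⟩, fun v hv => ?_⟩
  · obtain ⟨u, hu⟩ : ∃ u, u ∈ e := ⟨_, e.out_fst_mem⟩
    exact heC (hC.mem_edges_of_mem_symmDiff hM hM' (hends u hu) heD hu)
  · rw [List.mem_toFinset] at hv ⊢
    obtain ⟨f, g, hfg, hall⟩ := exists_two_edges_of_isCycle halt.1 hv
    obtain ⟨hf, hvf⟩ := (hall f).mpr (Or.inl rfl)
    by_cases hfe : f = e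
    · exact hends v (hfe ▸ hvf)
    · exact mem_support_of_mem_edge (hin f hf hfe) hvf

theorem card_symmDiff_add_card {α : Type*} [DecidableEq α] {D a : Finset α} {e : α} (he : e ∈ a)
    (heD : e ∉ D) (ha : ∀ f ∈ a, f ≠ e → f ∈ D) :
    (symmDiff D a).card + a.card = D.card + 2 := by
  have hsub : a.erase e ⊆ D := fun f hf =>
    ha f (Finset.mem_of_mem_erase hf) (Finset.ne_of_mem_erase hf)
  have heq : symmDiff D a = insert e (D \ a.erase e) := by
    ext f
    by_cases hfe : f = e
    · subst hfe; simp [Finset.mem_symmDiff, he, heD]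
    · have := ha f
      simp only [Finset.mem_symmDiff, Finset.mem_insert, Finset.mem_sdiff, Finset.mem_erase]
      tauto
  have h1 : (a.erase e).card + 1 = a.card := Finset.card_erase_add_one he
  have h2 : (D \ a.erase e).card + (a.erase e).card = D.card :=
    Finset.card_sdiff_add_card_eq_card hsub
  rw [heq, Finset.card_insert_of_notMem (by simp [heD])]
  omega

omit [DecidableEq V] in
theorem one_le_numCycles {G : SimpleGraph V} {D : Finset (Sym2 V)} {e : Sym2 V} (he : e ∈ D)
    (heG : e ∈ G.edgeSet) : 1 ≤ numCycles D := by
  induction e with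
  | h u w =>
    rw [numCycles, Nat.one_le_iff_ne_zero, Nat.card_ne_zero]
    exact ⟨⟨⟨_, u, w, by
      rw [SimpleGraph.fromEdgeSet_adj]
      exact ⟨he, (G.mem_edgeSet.mp heG).ne⟩, rfl⟩⟩, inferInstance⟩

/-- The edge set of a single closed walk spans at most one component. -/
theorem numCycles_edges_le_one {G : SimpleGraph V} {x : V} (C : G.Walk x x) :
    numCycles C.edges.toFinset ≤ 1 := by
  set H := SimpleGraph.fromEdgeSet (↑C.edges.toFinset : Set (Sym2 V)) with hH
  have hreach : ∀ v ∈ C.support, H.Reachable x v := by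
    intro v hv
    have hp : ∀ e ∈ (C.takeUntil v hv).edges, e ∈ H.edgeSet := by
      intro e he
      have heC := C.edges_takeUntil_subset_edges hv he
      rw [hH, SimpleGraph.edgeSet_fromEdgeSet]
      exact ⟨by simpa using heC, G.not_isDiag_of_mem_edgeSet (C.edges_subset_edgeSet heC)⟩
    exact ⟨(C.takeUntil v hv).transfer H hp⟩
  rw [numCycles, Finite.card_le_one_iff_subsingleton]
  have hx : ∀ cc : H.ConnectedComponent, (∃ u w, H.Adj u w ∧ H.connectedComponentMk u = cc) →
      H.connectedComponentMk x = cc := by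
    rintro cc ⟨u, w, huw, rfl⟩
    rw [hH, SimpleGraph.fromEdgeSet_adj] at huw
    exact SimpleGraph.ConnectedComponent.sound (hreach u
      (C.fst_mem_support_of_mem_edges (by simpa using huw.1)))
  exact ⟨fun a b => Subtype.ext ((hx a.1 a.2).symm.trans (hx b.1 b.2))⟩

/-- The edge sets of two vertex-disjoint cycles together span at least two components. -/
theorem two_le_numCycles_union {G : SimpleGraph V} {y z : V} {C' : G.Walk y y} {C'' : G.Walk z z}
    (h' : C'.IsCycle) (h'' : C''.IsCycle) (hdisj : ∀ w ∈ C'.support, w ∉ C''.support) :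
    2 ≤ numCycles (C'.edges.toFinset ∪ C''.edges.toFinset) := by
  set H := SimpleGraph.fromEdgeSet
    (↑(C'.edges.toFinset ∪ C''.edges.toFinset) : Set (Sym2 V)) with hH
  have hadj : ∀ u w, H.Adj u w ↔ (s(u, w) ∈ C'.edges ∨ s(u, w) ∈ C''.edges) ∧ u ≠ w := by
    intro u w
    rw [hH, SimpleGraph.fromEdgeSet_adj]
    simp
  have hclosed : ∀ u w, H.Walk u w → u ∈ C'.support → w ∈ C'.support := by
    intro u w p
    induction p with
    | nil => exact id
    | cons h _ ih =>
      intro hu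
      apply ih
      rcases ((hadj _ _).mp h).1 with h1 | h1
      · exact C'.snd_mem_support_of_mem_edges h1
      · exact absurd (C''.fst_mem_support_of_mem_edges h1) (hdisj _ hu)
  have hsnd : ∀ {t : V} {P : G.Walk t t}, P.IsCycle → ∃ w, s(t, w) ∈ P.edges ∧ t ≠ w := by
    intro t P hP
    obtain ⟨f, g, -, hall⟩ := exists_two_edges_of_isCycle hP P.start_mem_support
    obtain ⟨hf, w, rfl⟩ := (hall f).mpr (Or.inl rfl)
    exact ⟨w, hf, (P.adj_of_mem_edges hf).ne⟩
  obtain ⟨w', hw', hne'⟩ := hsnd h'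
  obtain ⟨w'', hw'', hne''⟩ := hsnd h''
  rw [numCycles]
  have hlt : 1 < Nat.card {cc : H.ConnectedComponent //
      ∃ u w, H.Adj u w ∧ H.connectedComponentMk u = cc} := by
    rw [Finite.one_lt_card_iff_nontrivial]
    refine ⟨⟨H.connectedComponentMk y, y, w', (hadj _ _).mpr ⟨Or.inl hw', hne'⟩, rfl⟩,
      ⟨H.connectedComponentMk z, z, w'', (hadj _ _).mpr ⟨Or.inr hw'', hne''⟩, rfl⟩, ?_⟩
    intro heq
    obtain ⟨p⟩ := SimpleGraph.ConnectedComponent.exact (Subtype.ext_iff.mp heq)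
    exact hdisj z (hclosed y z p C'.start_mem_support) C''.start_mem_support
  exact hlt

theorem rank_le_of_le_numCycles (G : SimpleGraph V) (N N' : Finset (Sym2 V)) {k : ℕ}
    (hk : k ≤ numCycles (symmDiff N N')) (hn : 6 ≤ Fintype.card V) :
    rank G N N' ≤ ((symmDiff N N').card : ℝ) + 1 / (1 + (k : ℝ)) + 1 / 6 := by
  have hk' : (k : ℝ) ≤ numCycles (symmDiff N N') := by exact_mod_cast hk
  have hn' : (6 : ℝ) ≤ Fintype.card V := by exact_mod_cast hn
  rw [rank]
  gcongr
  have : (0 : ℝ) ≤ max (maxDisjSM G N (symmDiff N N') : ℝ) (maxDisjSM G N' (symmDiff N N') : ℝ) :=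
    le_max_of_le_left (Nat.cast_nonneg _)
  nlinarith

theorem lt_rank_of_numCycles_le (G : SimpleGraph V) (N N' : Finset (Sym2 V)) {k : ℕ}
    (hk : numCycles (symmDiff N N') ≤ k) (hn : 6 ≤ Fintype.card V) :
    ((symmDiff N N').card : ℝ) + 1 / (1 + (k : ℝ)) < rank G N N' := by
  have hk' : (numCycles (symmDiff N N') : ℝ) ≤ k := by exact_mod_cast hk
  have hn' : (6 : ℝ) ≤ Fintype.card V := by exact_mod_cast hn
  have hmax : (0 : ℝ) ≤
      max (maxDisjSM G N (symmDiff N N') : ℝ) (maxDisjSM G N' (symmDiff N N') : ℝ) :=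
    le_max_of_le_left (Nat.cast_nonneg _)
  rw [rank]
  refine lt_add_of_le_of_pos ?_ (by positivity)
  gcongr

theorem rank_lt_of_card_lt {G : SimpleGraph V} {K K' N N' : Finset (Sym2 V)}
    (hcard : (symmDiff K K').card < (symmDiff N N').card)
    (hpos : 1 ≤ numCycles (symmDiff K K')) (hn : 6 ≤ Fintype.card V) :
    rank G K K' < rank G N N' := by
  have h1 := rank_le_of_le_numCycles G K K' hpos hn
  have h2 := lt_rank_of_numCycles_le G N N' le_rfl hn
  have h3 : ((symmDiff K K').card : ℝ) + 1 ≤ (symmDiff N N').card := by exact_mod_cast hcard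
  have h4 : (0 : ℝ) < 1 / (1 + (numCycles (symmDiff N N') : ℝ)) := by positivity
  norm_num at h1
  linarith


/-- applying one or both of two disjoint `M`-alternating simple
modifiers of a cycle of `M △ M'` yields perfect matchings of strictly smaller rank. -/
theorem stmt_11 (G : SimpleGraph V) (M M' : Finset (Sym2 V))
    (hM : IsPM G M) (hM' : IsPM G M')
    {x y z : V} (C : G.Walk x x) (hC : IsCycleIn G (symmDiff M M') C)
    (C' : G.Walk y y) (C'' : G.Walk z z)
    (h1 : IsSimpleModifier M C C') (h2 : IsSimpleModifier M C C'')
    (hdisj : ∀ w ∈ C'.support, w ∉ C''.support) :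
    (IsPM G (symmDiff M C'.edges.toFinset) ∧
      max (rank G (symmDiff M C'.edges.toFinset) M) (rank G (symmDiff M C'.edges.toFinset) M')
        < rank G M M') ∧
    (IsPM G (symmDiff M C''.edges.toFinset) ∧
      max (rank G (symmDiff M C''.edges.toFinset) M) (rank G (symmDiff M C''.edges.toFinset) M')
        < rank G M M') ∧
    (IsPM G (symmDiff (symmDiff M C'.edges.toFinset) C''.edges.toFinset) ∧
      max (rank G (symmDiff (symmDiff M C'.edges.toFinset) C''.edges.toFinset) M)
          (rank G (symmDiff (symmDiff M C'.edges.toFinset) C''.edges.toFinset) M')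
        < rank G M M') := by
  have hc1 := h1.1.1
  have hc2 := h2.1.1
  obtain ⟨⟨e, he, heD, hein⟩, hsub1⟩ := h1.exists_chord hM hM' hC
  obtain ⟨⟨f, hf, hfD, hfin⟩, hsub2⟩ := h2.exists_chord hM hM' hC
  have heG : e ∈ G.edgeSet := C'.edges_subset_edgeSet (List.mem_toFinset.mp he)
  have hfG : f ∈ G.edgeSet := C''.edges_subset_edgeSet (List.mem_toFinset.mp hf)
  have hab : ∀ g ∈ C'.edges.toFinset, g ∉ C''.edges.toFinset := fun g hg hg' =>
    hdisj _ (mem_support_of_mem_edge (List.mem_toFinset.mp hg) g.out_fst_mem)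
      (mem_support_of_mem_edge (List.mem_toFinset.mp hg') g.out_fst_mem)
  have hvert : C'.length + C''.length ≤ C.length := by
    rw [← card_support_of_isCycle hc1, ← card_support_of_isCycle hc2,
      ← card_support_of_isCycle hC.1, ← Finset.card_union_of_disjoint]
    · exact Finset.card_le_card (Finset.union_subset hsub1 hsub2)
    · exact Finset.disjoint_left.mpr fun w hw hw' =>
        hdisj w (List.mem_toFinset.mp hw) (List.mem_toFinset.mp hw')
  have hCD : C.edges.toFinset ⊆ symmDiff M M' := fun g hg => hC.2 g (List.mem_toFinset.mp hg)
  have hcardC := card_edges_of_isCycle hC.1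
  have hcard1 := card_edges_of_isCycle hc1
  have hcard2 := card_edges_of_isCycle hc2
  have hCle := Finset.card_le_card hCD
  have hl1 := hc1.three_le_length
  have hl2 := hc2.three_le_length
  have hn : 6 ≤ Fintype.card V := by
    have := Finset.card_le_univ C.support.toFinset
    rw [card_support_of_isCycle hC.1] at this
    omega
  have hD1 := card_symmDiff_add_card he heD hein
  have hD2 := card_symmDiff_add_card hf hfD hfin
  have hfD' : f ∉ symmDiff (symmDiff M M') C'.edges.toFinset := fun h => by
    rcases Finset.mem_symmDiff.mp h with ⟨h, -⟩ | ⟨h, -⟩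
    · exact hfD h
    · exact hab f h hf
  have hD3 := card_symmDiff_add_card hf hfD' fun g hg hgf =>
    Finset.mem_symmDiff.mpr (Or.inl ⟨hfin g hg hgf, fun h => hab g h hg⟩)
  have hM1 : IsPM G (symmDiff M C'.edges.toFinset) :=
    hM.symmDiff_cycle hc1 fun v hv => exists_matching_edge_of_isAltCycle h1.1 hv
  have hunion : symmDiff C'.edges.toFinset C''.edges.toFinset =
      C'.edges.toFinset ∪ C''.edges.toFinset :=
    (Finset.disjoint_left.mpr fun g hg hg' => hab g hg hg').symmDiff_eq_sup
  have hucard : (C'.edges.toFinset ∪ C''.edges.toFinset).card = C'.length + C''.length := by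
    rw [Finset.card_union_of_disjoint (Finset.disjoint_left.mpr fun g hg hg' => hab g hg hg'),
      hcard1, hcard2]
  have hself : ∀ a : Finset (Sym2 V), symmDiff (symmDiff M a) M = a := fun a => by
    rw [symmDiff_comm M a, symmDiff_symmDiff_cancel_right]
  have hright : ∀ a : Finset (Sym2 V),
      symmDiff (symmDiff M a) M' = symmDiff (symmDiff M M') a := fun a => symmDiff_right_comm M a M'
  refine ⟨⟨hM1, max_lt ?_ ?_⟩, ⟨?_, max_lt ?_ ?_⟩, ⟨?_, max_lt ?_ ?_⟩⟩
  · apply rank_lt_of_card_lt _ _ hn <;> rw [hself]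
    · omega
    · exact one_le_numCycles he heG
  · apply rank_lt_of_card_lt _ _ hn <;> rw [hright]
    · omega
    · exact one_le_numCycles (Finset.mem_symmDiff.mpr (Or.inr ⟨he, heD⟩)) heG
  · exact hM.symmDiff_cycle hc2 fun v hv => exists_matching_edge_of_isAltCycle h2.1 hv
  · apply rank_lt_of_card_lt _ _ hn <;> rw [hself]
    · omega
    · exact one_le_numCycles hf hfG
  · apply rank_lt_of_card_lt _ _ hn <;> rw [hright]
    · omega
    · exact one_le_numCycles (Finset.mem_symmDiff.mpr (Or.inr ⟨hf, hfD⟩)) hfG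
  · refine hM1.symmDiff_cycle hc2 fun v hv => ?_
    obtain ⟨g, hg, hgM, hvg⟩ := exists_matching_edge_of_isAltCycle h2.1 hv
    exact ⟨g, hg, Finset.mem_symmDiff.mpr
      (Or.inl ⟨hgM, fun h => hab g h (List.mem_toFinset.mpr hg)⟩), hvg⟩
  · have hS : symmDiff (symmDiff (symmDiff M C'.edges.toFinset) C''.edges.toFinset) M =
        C'.edges.toFinset ∪ C''.edges.toFinset := by
      rw [symmDiff_assoc M, hself, hunion]
    have htwo := two_le_numCycles_union hc1 hc2 hdisj
    rcases lt_or_ge (C'.length + C''.length) (symmDiff M M').card with hlt | hge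
    · apply rank_lt_of_card_lt _ _ hn <;> rw [hS] <;> omega
    · have hDC : C.edges.toFinset = symmDiff M M' :=
        Finset.eq_of_subset_of_card_le hCD (by omega)
      have hone := numCycles_edges_le_one C
      rw [hDC] at hone
      rw [← hS] at htwo hucard
      have hup := rank_le_of_le_numCycles G _ _ htwo hn
      have hlow := lt_rank_of_numCycles_le G _ _ hone hn
      have hle : ((symmDiff (symmDiff (symmDiff M C'.edges.toFinset) C''.edges.toFinset) M).card
          : ℝ) ≤ (symmDiff M M').card := by
        rw [hucard]
        exact_mod_cast hvert.trans (hcardC ▸ hCle)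
      norm_num at hup hlow
      linarith
  · have hS : symmDiff (symmDiff (symmDiff M C'.edges.toFinset) C''.edges.toFinset) M' =
        symmDiff (symmDiff (symmDiff M M') C'.edges.toFinset) C''.edges.toFinset := by
      rw [symmDiff_right_comm, hright]
    apply rank_lt_of_card_lt _ _ hn <;> rw [hS]
    · omega
    · exact one_le_numCycles (Finset.mem_symmDiff.mpr (Or.inr ⟨hf, hfD'⟩)) hfG
end

section
/- Let (G,c) be a red-blue edge-colored graph such that every even cycle of G of length at least 6 has an odd chord (in particular this holds if G is bipartite chordal or strongly chordal). Then (G,c) satisfies Karzanov's weak property: for any two perfect matchings M and M' and any integer k with r(M) ≤ k ≤ r(M'), there exists a perfect matching M'' with r(M'') ∈ {k, k+1}. -/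
variable {V : Type*} [Fintype V] [DecidableEq V]

/-- The `i`-th vertex (cyclically, indices mod `C.length`) along a closed walk `C`. -/
def cvtx {G : SimpleGraph V} {v : V} (C : G.Walk v v) (i : ℕ) : V :=
  C.support.tail.getD (i % C.length) v

/-- Positions `i, j` on the cycle `C` carry a chord: the corresponding vertices are
adjacent in `G` but the edge is not an edge of `C`. -/
def IsChordAt {G : SimpleGraph V} {v : V} (C : G.Walk v v) (i j : ℕ) : Prop :=
  G.Adj (cvtx C i) (cvtx C j) ∧ s(cvtx C i, cvtx C j) ∉ C.edges

/-- `C` has an odd chord: a chord splitting `C` into two odd-length paths. -/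
def HasOddChord {G : SimpleGraph V} {v : V} (C : G.Walk v v) : Prop :=
  ∃ i j : ℕ, i < j ∧ j < C.length ∧ Odd (j - i) ∧ IsChordAt C i j

/-- `C` has two adjacent odd chords: chords `{u,v₀} = {cvtx i, cvtx (i+d)}` and
`{x,y} = {cvtx (i+d+1), cvtx (i+n-1)}` whose endpoints appear in cyclic order
`u, v₀, x, y` with `{v₀,x}` and `{y,u}` edges of `C`, both chords odd. -/
def HasTwoAdjOddChords {G : SimpleGraph V} {v : V} (C : G.Walk v v) : Prop :=
  ∃ i d : ℕ, 1 ≤ d ∧ d + 3 ≤ C.length ∧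
    IsChordAt C i (i + d) ∧ (Odd d ∨ Odd (C.length - d)) ∧
    IsChordAt C (i + d + 1) (i + C.length - 1) ∧
    (Odd (C.length - d - 2) ∨ Odd (d + 2))

/-- `f` sends every vertex to its partner in a perfect matching of `G`. -/
structure IsPartner (G : SimpleGraph V) (f : V → V) : Prop where
  adj : ∀ v, G.Adj v (f v)
  invol : ∀ v, f (f v) = v

/-- The vertices covered by red edges of the matching with partner map `f`. -/
def redVerts (c : Sym2 V → Bool) (f : V → V) : Finset V :=
  Finset.univ.filter fun v => c s(v, f v) = true

/-- The vertices at which two partner maps disagree. -/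
def disagree (f g : V → V) : Finset V :=
  Finset.univ.filter fun v => f v ≠ g v

lemma mem_disagree {f g : V → V} {v : V} : v ∈ disagree f g ↔ f v ≠ g v := by
  simp [disagree]

lemma disagree_comm (f g : V → V) : disagree f g = disagree g f := by
  ext v; simp [mem_disagree, ne_comm]

lemma card_redVerts_le (c : Sym2 V → Bool) (f h : V → V) :
    (redVerts c h).card ≤ (redVerts c f).card + (disagree f h).card := by
  refine (Finset.card_le_card ?_).trans (Finset.card_union_le _ _)
  intro v hv
  by_cases hfh : f v = h v
  · simp_all [redVerts]
  · simp [mem_disagree, hfh]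

lemma IsPM.exists_partner {G : SimpleGraph V} {M : Finset (Sym2 V)} (hM : IsPM G M) :
    ∃ f, IsPartner G f ∧ M = Finset.univ.image fun v => s(v, f v) := by
  obtain ⟨hE, hU⟩ := hM
  have hex : ∀ v, ∃ w, s(v, w) ∈ M := by
    intro v
    obtain ⟨e, ⟨he, hve⟩, -⟩ := hU v
    obtain ⟨w, rfl⟩ := Sym2.mem_iff_exists.1 hve
    exact ⟨w, he⟩
  choose f hf using hex
  have huniq : ∀ v e, e ∈ M → v ∈ e → e = s(v, f v) := fun v e he hv =>
    (hU v).unique ⟨he, hv⟩ ⟨hf v, Sym2.mem_mk_left _ _⟩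
  refine ⟨f, ⟨fun v => hE _ (hf v), fun v => ?_⟩, ?_⟩
  · have h := huniq (f v) _ (hf v) (Sym2.mem_mk_right _ _)
    rw [Sym2.eq_swap, Sym2.congr_right] at h
    exact h.symm
  · ext e
    simp only [Finset.mem_image, Finset.mem_univ, true_and]
    constructor
    · intro he
      induction e with
      | _ a b => exact ⟨a, (huniq a _ he (Sym2.mem_mk_left _ _)).symm⟩
    · rintro ⟨v, rfl⟩
      exact hf v

namespace IsPartner

variable {G : SimpleGraph V} {f g : V → V}

lemma mk_eq_mk_iff {V : Type*} {G : SimpleGraph V} {f : V → V} (hf : IsPartner G f)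
    {v w : V} :
    s(v, f v) = s(w, f w) ↔ v = w ∨ v = f w := by
  rw [Sym2.eq_iff]
  constructor
  · rintro (⟨h, -⟩ | ⟨h, -⟩)
    exacts [.inl h, .inr h]
  · rintro (rfl | rfl)
    exacts [.inl ⟨rfl, rfl⟩, .inr ⟨rfl, hf.invol w⟩]

lemma isPM (hf : IsPartner G f) : IsPM G (Finset.univ.image fun v => s(v, f v)) := by
  refine ⟨?_, fun v => ⟨s(v, f v),
    ⟨Finset.mem_image_of_mem _ (Finset.mem_univ v), Sym2.mem_mk_left _ _⟩, ?_⟩⟩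
  · simp only [Finset.mem_image, Finset.mem_univ, true_and]
    rintro e ⟨v, rfl⟩
    exact hf.adj v
  · simp only [Finset.mem_image, Finset.mem_univ, true_and]
    rintro e ⟨⟨w, rfl⟩, hv⟩
    rw [hf.mk_eq_mk_iff]
    rcases Sym2.mem_iff.1 hv with rfl | rfl
    exacts [.inl rfl, .inr (hf.invol w).symm]

lemma card_redVerts (hf : IsPartner G f) (c : Sym2 V → Bool) :
    (redVerts c f).card = 2 * redCount c (Finset.univ.image fun v => s(v, f v)) := by
  have hmaps : ∀ v ∈ redVerts c f, s(v, f v) ∈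
      (Finset.univ.image fun v => s(v, f v)).filter (fun e => c e = true) := by
    intro v hv
    exact Finset.mem_filter.2
      ⟨Finset.mem_image_of_mem _ (Finset.mem_univ v), (Finset.mem_filter.1 hv).2⟩
  rw [Finset.card_eq_sum_card_fiberwise hmaps, redCount, Finset.sum_const_nat (m := 2), mul_comm]
  intro e he
  simp only [Finset.mem_filter, Finset.mem_image, Finset.mem_univ, true_and] at he
  obtain ⟨⟨v, rfl⟩, hc⟩ := he
  rw [Finset.card_eq_two]
  refine ⟨v, f v, (hf.adj v).ne, ?_⟩
  ext w
  simp only [redVerts, Finset.mem_filter, Finset.mem_univ, true_and, hf.mk_eq_mk_iff,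
    Finset.mem_insert, Finset.mem_singleton]
  refine and_iff_right_of_imp ?_
  intro h
  rwa [hf.mk_eq_mk_iff.2 h]

lemma piecewise {V : Type*} [DecidableEq V] {G : SimpleGraph V} {f g : V → V}
    (hf : IsPartner G f) (hg : IsPartner G g) (S : Finset V)
    (hfS : ∀ v ∈ S, f v ∈ S) (hgS : ∀ v ∈ S, g v ∈ S) : IsPartner G (S.piecewise g f) := by
  refine ⟨fun v => ?_, fun v => ?_⟩ <;> by_cases hv : v ∈ S
  · simpa [hv] using hg.adj v
  · simpa [hv] using hf.adj v
  · simp [hv, hgS v hv, hg.invol]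
  · have : f v ∉ S := fun h => hv (hf.invol v ▸ hfS _ h)
    simp [hv, this, hf.invol]

lemma apply_mem_disagree (hf : IsPartner G f) (hg : IsPartner G g) {v : V}
    (hv : v ∈ disagree f g) : f v ∈ disagree f g := by
  rw [mem_disagree] at hv ⊢
  intro h
  rw [hf.invol] at h
  exact hv (by rw [← hg.invol (f v), ← h])

/-- Exchanging two matchings along an alternating path closed up by an edge `uw`: the interior `T`
of the path is matched by `g`, the whole path by `f`. -/
lemma exists_exchange (hf : IsPartner G f) (hg : IsPartner G g) {T : Finset V} {u w z t : V}
    (huw : G.Adj u w) (hu : u ∉ T) (hw : w ∉ T) (hgT : ∀ v ∈ T, g v ∈ T)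
    (hfS : ∀ v ∈ insert u (insert w T), f v ∈ insert u (insert w T))
    (hS : insert u (insert w T) ⊆ disagree f g)
    (hz : z ∈ disagree f g) (hzS : z ∉ insert u (insert w T)) (ht : t ∈ T) :
    ∃ h, IsPartner G h ∧ (disagree f h).card < (disagree f g).card ∧
      (disagree h g).card < (disagree f g).card := by
  have hne := huw.ne
  set h : V → V := fun v => if v = u then w else if v = w then u else if v ∈ T then g v else f v
    with h_def
  have h_u : h u = w := by simp [h_def]
  have h_w : h w = u := by simp [h_def, hne.symm]
  have h_T : ∀ v ∈ T, h v = g v := by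
    intro v hv
    have h1 : v ≠ u := by rintro rfl; exact hu hv
    have h2 : v ≠ w := by rintro rfl; exact hw hv
    simp [h_def, hv, h1, h2]
  have h_S : ∀ v, v ∉ insert u (insert w T) → h v = f v := by
    intro v hv
    simp only [Finset.mem_insert, not_or] at hv
    simp [h_def, hv]
  refine ⟨h, ⟨fun v => ?_, fun v => ?_⟩, Finset.card_lt_card ?_, Finset.card_lt_card ?_⟩
  · by_cases hv : v ∈ insert u (insert w T)
    · simp only [Finset.mem_insert] at hv
      rcases hv with rfl | rfl | hv
      · rwa [h_u]
      · rw [h_w]; exact huw.symm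
      · rw [h_T v hv]; exact hg.adj v
    · rw [h_S v hv]; exact hf.adj v
  · by_cases hv : v ∈ insert u (insert w T)
    · simp only [Finset.mem_insert] at hv
      rcases hv with rfl | rfl | hv
      · rw [h_u, h_w]
      · rw [h_w, h_u]
      · rw [h_T v hv, h_T _ (hgT v hv), hg.invol]
    · rw [h_S v hv, h_S, hf.invol]
      exact fun hmem => hv (hf.invol v ▸ hfS _ hmem)
  · refine (Finset.ssubset_iff_of_subset fun v hv => ?_).2
      ⟨z, hz, by simp [mem_disagree, h_S z hzS]⟩
    by_contra hvD
    exact mem_disagree.1 hv (h_S v fun hmem => hvD (hS hmem)).symm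
  · refine (Finset.ssubset_iff_of_subset fun v hv => ?_).2
      ⟨t, hS (by simp [ht]), by simp [mem_disagree, h_T t ht]⟩
    by_contra hvD
    rw [mem_disagree, h_S v fun hmem => hvD (hS hmem)] at hv
    exact hvD (mem_disagree.2 hv)

/-- The exchange along the segment from `x a` to `x b` of an alternating cycle `x 1, …, x n`. -/
lemma exists_exchange_of_chord (hf : IsPartner G f) (hg : IsPartner G g) {x : ℕ → V} {n a b : ℕ}
    (hinj : Set.InjOn x (Set.Icc 1 n)) (hD : ∀ i, x i ∈ disagree f g)
    (hfx : ∀ i, Even (i + a) → f (x i) = x (i + 1))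
    (hgx : ∀ i, Odd (i + a) → g (x i) = x (i + 1))
    (ha : 1 ≤ a) (hab : a + 3 ≤ b) (hbn : b ≤ n) (hlen : b + 2 ≤ n + a)
    (hodd : Odd (b + a)) (hadj : G.Adj (x a) (x b)) :
    ∃ h, IsPartner G h ∧ (disagree f h).card < (disagree f g).card ∧
      (disagree h g).card < (disagree f g).card := by
  have hx : ∀ i j, 1 ≤ i → i ≤ n → 1 ≤ j → j ≤ n → x i = x j → i = j :=
    fun i j h1 h2 h3 h4 h => hinj ⟨h1, h2⟩ ⟨h3, h4⟩ h
  have hmem : ∀ v, v ∈ insert (x a) (insert (x b) ((Finset.Ioo a b).image x)) ↔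
      ∃ i, a ≤ i ∧ i ≤ b ∧ x i = v := by
    intro v
    simp only [Finset.mem_insert, Finset.mem_image, Finset.mem_Ioo]
    constructor
    · rintro (rfl | rfl | ⟨i, hi, rfl⟩)
      exacts [⟨a, by omega, by omega, rfl⟩, ⟨b, by omega, by omega, rfl⟩,
        ⟨i, by omega, by omega, rfl⟩]
    · rintro ⟨i, h1, h2, rfl⟩
      by_cases hia : i = a
      · exact .inl (by rw [hia])
      by_cases hib : i = b
      · exact .inr (.inl (by rw [hib]))
      exact .inr (.inr ⟨i, by omega, rfl⟩)
  obtain ⟨p, hp1, hp2, hp⟩ : ∃ p, 1 ≤ p ∧ p ≤ n ∧ (p < a ∨ b < p) := by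
    by_cases h : b < n
    · exact ⟨b + 1, by omega, by omega, by omega⟩
    · exact ⟨a - 1, by omega, by omega, by omega⟩
  refine hf.exists_exchange hg (T := (Finset.Ioo a b).image x) (z := x p) (t := x (a + 1))
    hadj ?_ ?_ ?_ ?_ ?_ (hD p) ?_ ?_
  · simp only [Finset.mem_image, Finset.mem_Ioo, not_exists, not_and]
    intro i hi h
    have := hx i a (by omega) (by omega) (by omega) (by omega) h
    omega
  · simp only [Finset.mem_image, Finset.mem_Ioo, not_exists, not_and]
    intro i hi h
    have := hx i b (by omega) (by omega) (by omega) (by omega) h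
    omega
  · simp only [Finset.mem_image, Finset.mem_Ioo]
    rintro _ ⟨i, hi, rfl⟩
    rcases Nat.even_or_odd (i + a) with he | ho
    · obtain ⟨j, rfl⟩ : ∃ j, i = j + 1 := ⟨i - 1, by omega⟩
      refine ⟨j, by grind, ?_⟩
      rw [← hgx j (by grind), hg.invol]
    · exact ⟨i + 1, by grind, (hgx i ho).symm⟩
  · intro v hv
    rw [hmem] at hv ⊢
    obtain ⟨i, h1, h2, rfl⟩ := hv
    rcases Nat.even_or_odd (i + a) with he | ho
    · exact ⟨i + 1, by omega, by grind, (hfx i he).symm⟩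
    · obtain ⟨j, rfl⟩ : ∃ j, i = j + 1 := ⟨i - 1, by omega⟩
      refine ⟨j, by grind, by omega, ?_⟩
      rw [← hfx j (by grind), hf.invol]
  · intro v hv
    obtain ⟨i, -, -, rfl⟩ := (hmem v).1 hv
    exact hD i
  · rw [hmem]
    rintro ⟨i, h1, h2, h⟩
    have := hx i p (by omega) (by omega) (by omega) (by omega) h
    omega
  · exact Finset.mem_image_of_mem _ (Finset.mem_Ioo.2 (by omega))

end IsPartner

/-- The sequence `v, f v, g (f v), f (g (f v)), …`. -/
def altSeq (f g : V → V) (v : V) : ℕ → V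
  | 0 => v
  | n + 1 => if Even n then f (altSeq f g v n) else g (altSeq f g v n)

section altSeq

variable {V : Type*} {G : SimpleGraph V} {f g : V → V} {v : V}

lemma altSeq_even {i : ℕ} (hi : Even i) : f (altSeq f g v i) = altSeq f g v (i + 1) := by
  simp [altSeq, hi]

lemma altSeq_odd {i : ℕ} (hi : Odd i) : g (altSeq f g v i) = altSeq f g v (i + 1) := by
  simp [altSeq, Nat.not_even_iff_odd.2 hi]

lemma altSeq_even' (hf : IsPartner G f) {i : ℕ} (hi : Even i) :
    f (altSeq f g v (i + 1)) = altSeq f g v i := by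
  rw [← altSeq_even hi, hf.invol]

lemma altSeq_odd' (hg : IsPartner G g) {i : ℕ} (hi : Odd i) :
    g (altSeq f g v (i + 1)) = altSeq f g v i := by
  rw [← altSeq_odd hi, hg.invol]

lemma altSeq_adj (hf : IsPartner G f) (hg : IsPartner G g) (i : ℕ) :
    G.Adj (altSeq f g v i) (altSeq f g v (i + 1)) := by
  rcases Nat.even_or_odd i with h | h
  · rw [← altSeq_even h]; exact hf.adj _
  · rw [← altSeq_odd h]; exact hg.adj _

lemma altSeq_mem_disagree [Fintype V] [DecidableEq V] (hf : IsPartner G f) (hg : IsPartner G g)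
    (hv : v ∈ disagree f g) (i : ℕ) : altSeq f g v i ∈ disagree f g := by
  induction i with
  | zero => exact hv
  | succ i ih =>
    rcases Nat.even_or_odd i with h | h
    · rw [← altSeq_even h]; exact hf.apply_mem_disagree hg ih
    · rw [← altSeq_odd h]
      rw [disagree_comm] at ih ⊢
      exact hg.apply_mem_disagree hf ih

lemma altSeq_ne_add_odd (hf : IsPartner G f) (hg : IsPartner G g) (i s : ℕ) :
    altSeq f g v i ≠ altSeq f g v (i + 2 * s + 1) := by
  induction s generalizing i with
  | zero => exact (altSeq_adj hf hg i).ne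
  | succ s ih =>
    intro h
    apply ih (i + 1)
    rcases Nat.even_or_odd i with hi | hi
    · rw [← altSeq_even hi, h, show i + 2 * (s + 1) + 1 = (i + 2 * s + 2) + 1 by ring,
        altSeq_even' hf (by grind)]
      congr 1; ring
    · rw [← altSeq_odd hi, h, show i + 2 * (s + 1) + 1 = (i + 2 * s + 2) + 1 by ring,
        altSeq_odd' hg (by grind)]
      congr 1; ring

lemma altSeq_eq_add_even (hf : IsPartner G f) (hg : IsPartner G g) {i t : ℕ}
    (h : altSeq f g v i = altSeq f g v (i + 2 * t)) : altSeq f g v (2 * t) = v := by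
  induction i with
  | zero => simpa [altSeq] using h.symm
  | succ i ih =>
    apply ih
    rcases Nat.even_or_odd i with hi | hi
    · rw [← altSeq_even' hf hi, h, show i + 1 + 2 * t = i + 2 * t + 1 by ring,
        altSeq_even' hf (by grind)]
    · rw [← altSeq_odd' hg hi, h, show i + 1 + 2 * t = i + 2 * t + 1 by ring,
        altSeq_odd' hg (by grind)]

/-- The alternating sequence closes up to a cycle of even length at least four. -/
lemma exists_altSeq_period [Fintype V] [DecidableEq V] (hf : IsPartner G f) (hg : IsPartner G g)
    (hv : v ∈ disagree f g) :
    ∃ m, 2 ≤ m ∧ altSeq f g v (2 * m) = v ∧ Set.InjOn (altSeq f g v) (Set.Icc 1 (2 * m)) := by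
  have hex : ∃ m, 0 < m ∧ altSeq f g v (2 * m) = v := by
    obtain ⟨i, j, hij, h⟩ := Finite.exists_ne_map_eq_of_infinite fun i => altSeq f g v (2 * i)
    wlog hlt : i < j generalizing i j
    · exact this j i hij.symm h.symm (by omega)
    refine ⟨j - i, by omega, altSeq_eq_add_even hf hg (i := 2 * i) ?_⟩
    rw [show 2 * i + 2 * (j - i) = 2 * j by omega]
    exact h
  obtain ⟨hpos, hper⟩ := Nat.find_spec hex
  refine ⟨Nat.find hex, ?_, hper, ?_⟩
  · by_contra hlt
    have h1 : Nat.find hex = 1 := by omega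
    rw [h1] at hper
    have h2 : g (f v) = v := hper
    apply mem_disagree.1 hv
    rw [← hg.invol (f v), h2]
  · intro i hi j hj h
    by_contra hij
    wlog hlt : i < j generalizing i j
    · exact this hj hi h.symm (Ne.symm hij) (by omega)
    rcases Nat.even_or_odd' (j - i) with ⟨t, ht | ht⟩
    · have h0 : altSeq f g v (2 * t) = v :=
        altSeq_eq_add_even hf hg (i := i) (by rw [h]; congr 1; omega)
      have := Nat.find_min' hex ⟨by omega, h0⟩
      simp only [Set.mem_Icc] at hi hj
      omega
    · apply altSeq_ne_add_odd hf hg i t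
      rw [h]; congr 1; omega

end altSeq

lemma SimpleGraph.exists_walk_of_seq {V : Type*} {G : SimpleGraph V} {x : ℕ → V}
    (hadj : ∀ i, G.Adj (x i) (x (i + 1))) (n : ℕ) :
    ∃ p : G.Walk (x 0) (x n), p.length = n ∧ p.support = (List.range (n + 1)).map x ∧
      p.edges = (List.range n).map fun i => s(x i, x (i + 1)) := by
  induction n with
  | zero => exact ⟨.nil, by simp⟩
  | succ n ih =>
    obtain ⟨p, h1, h2, h3⟩ := ih
    refine ⟨p.concat (hadj n), by simp [h1], ?_, ?_⟩
    · rw [SimpleGraph.Walk.support_concat, h2, List.range_succ (n := n + 1)]; simp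
    · rw [SimpleGraph.Walk.edges_concat, h3, List.range_succ]; simp

lemma SimpleGraph.exists_cycle_of_seq {V : Type*} {G : SimpleGraph V} {x : ℕ → V} {n : ℕ}
    (hn : 3 ≤ n) (hadj : ∀ i, G.Adj (x i) (x (i + 1))) (hclose : x n = x 0)
    (hinj : Set.InjOn x (Set.Icc 1 n)) :
    ∃ C : G.Walk (x 0) (x 0), C.IsCycle ∧ C.length = n ∧
      C.support.tail = (List.range n).map (fun i => x (i + 1)) ∧
      C.edges = (List.range n).map fun i => s(x i, x (i + 1)) := by
  obtain ⟨p, hl, hs, he⟩ := SimpleGraph.exists_walk_of_seq hadj n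
  have hx : ∀ i j, 1 ≤ i → i ≤ n → 1 ≤ j → j ≤ n → x i = x j → i = j :=
    fun i j h1 h2 h3 h4 h => hinj ⟨h1, h2⟩ ⟨h3, h4⟩ h
  have htail : (p.copy rfl hclose).support.tail = (List.range n).map (fun i => x (i + 1)) := by
    rw [SimpleGraph.Walk.support_copy, hs, List.range_succ_eq_map]
    simp [Function.comp_def]
  refine ⟨p.copy rfl hclose, ?_, by simpa using hl, htail, by simpa using he⟩
  rw [SimpleGraph.Walk.isCycle_def, SimpleGraph.Walk.isTrail_def, htail]
  refine ⟨?_, ?_, ?_⟩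
  · rw [SimpleGraph.Walk.edges_copy, he]
    refine List.Nodup.map_on ?_ List.nodup_range
    intro i hi j hj h
    rw [List.mem_range] at hi hj
    rcases Sym2.eq_iff.1 h with ⟨-, h⟩ | ⟨h, h'⟩
    · have := hx _ _ (by omega) (by omega) (by omega) (by omega) h
      omega
    · rcases Nat.eq_zero_or_pos i with rfl | hi0
      · have h3 := hx _ _ (by omega) le_rfl (by omega) (by omega) (hclose.trans h)
        rcases Nat.eq_zero_or_pos j with rfl | hj0
        · rfl
        · have := hx _ _ (by omega) (by omega) (by omega) (by omega) h'
          omega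
      · have h3 := hx _ _ (by omega) (by omega) (by omega) (by omega) h
        rcases Nat.eq_zero_or_pos j with rfl | hj0
        · have := hx _ _ (by omega) (by omega) (by omega) le_rfl (h'.trans hclose.symm)
          omega
        · have := hx _ _ (by omega) (by omega) (by omega) (by omega) h'
          omega
  · intro h
    have := congrArg SimpleGraph.Walk.length h
    rw [SimpleGraph.Walk.length_copy, hl, SimpleGraph.Walk.length_nil] at this
    omega
  · refine List.Nodup.map_on ?_ List.nodup_range
    intro i hi j hj h
    rw [List.mem_range] at hi hj
    have := hx _ _ (by omega) (by omega) (by omega) (by omega) h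
    omega

/-- An odd chord of a cycle given by a sequence of vertices, by positions in the sequence. -/
lemma exists_chord_of_hasOddChord {V : Type*} {G : SimpleGraph V} {x : ℕ → V} {n : ℕ}
    (hclose : x n = x 0) {C : G.Walk (x 0) (x 0)} (hl : C.length = n)
    (hs : C.support.tail = (List.range n).map (fun i => x (i + 1)))
    (he : C.edges = (List.range n).map fun i => s(x i, x (i + 1))) (h : HasOddChord C) :
    ∃ a b, 1 ≤ a ∧ a + 3 ≤ b ∧ b ≤ n ∧ b + 2 ≤ n + a ∧ Odd (b + a) ∧ G.Adj (x a) (x b) := by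
  obtain ⟨i, j, hij, hj, hodd, hadj, hmem⟩ := h
  have hv : ∀ t, t < n → cvtx C t = x (t + 1) := by
    intro t ht
    simp [cvtx, hs, hl, Nat.mod_eq_of_lt ht, ht]
  rw [hl] at hj
  rw [hv i (by omega), hv j hj] at hadj hmem
  have hmem' : ∀ t, t < n → s(x t, x (t + 1)) ≠ s(x (i + 1), x (j + 1)) := by
    intro t ht h
    exact hmem (by rw [he, ← h]; exact List.mem_map.2 ⟨t, by simpa using ht, rfl⟩)
  have h1 : j ≠ i + 1 := by
    rintro rfl
    exact hmem' (i + 1) hj rfl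
  have h2 : ¬ (i = 0 ∧ j + 1 = n) := by
    rintro ⟨rfl, hjn⟩
    apply hmem' 0 (by omega)
    rw [hjn, hclose, Sym2.eq_swap]
  have h3 : i + 3 ≤ j := by grind
  exact ⟨i + 1, j + 1, by omega, by omega, by omega, by omega, by grind, hadj⟩

/-- The discrete intermediate value property, in terms of partner maps. -/
lemma IsPartner.exists_card_redVerts {G : SimpleGraph V} (c : Sym2 V → Bool)
    (hchord : ∀ (v : V) (C : G.Walk v v), C.IsCycle → Even C.length → 6 ≤ C.length →
      HasOddChord C) (k : ℕ) {f g : V → V} (hf : IsPartner G f) (hg : IsPartner G g)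
    (hfk : (redVerts c f).card ≤ 2 * k) (hgk : 2 * k ≤ (redVerts c g).card) :
    ∃ h, IsPartner G h ∧ ((redVerts c h).card = 2 * k ∨ (redVerts c h).card = 2 * (k + 1)) := by
  induction hN : (disagree f g).card using Nat.strong_induction_on generalizing f g with
  | _ N ih =>
  subst hN
  by_cases hfk' : (redVerts c f).card = 2 * k
  · exact ⟨f, hf, .inl hfk'⟩
  have split : (∃ h, IsPartner G h ∧ (disagree f h).card < (disagree f g).card ∧
      (disagree h g).card < (disagree f g).card) →
      ∃ h, IsPartner G h ∧
        ((redVerts c h).card = 2 * k ∨ (redVerts c h).card = 2 * (k + 1)) := by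
    rintro ⟨h, hh, h1, h2⟩
    rcases le_total (redVerts c h).card (2 * k) with hle | hle
    · exact ih _ h2 hh hg hle hgk rfl
    · exact ih _ h1 hf hh hfk hle rfl
  obtain ⟨v, hv⟩ : (disagree f g).Nonempty := by
    by_contra hD
    have h := card_redVerts_le c f g
    rw [Finset.not_nonempty_iff_eq_empty.1 hD, Finset.card_empty] at h
    omega
  obtain ⟨m, hm, hper, hinj⟩ := exists_altSeq_period hf hg hv
  have hD := altSeq_mem_disagree hf hg hv
  set x := altSeq f g v
  have hclose : x (2 * m) = x 0 := hper
  rcases hm.eq_or_lt with rfl | hm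
  · set S : Finset V := (Finset.range 4).image x with hS
    have hfS : ∀ w ∈ S, f w ∈ S := by
      intro w hw
      simp only [hS, Finset.mem_image, Finset.mem_range] at hw ⊢
      obtain ⟨i, hi, rfl⟩ := hw
      rcases Nat.even_or_odd i with h | h
      · exact ⟨i + 1, by grind, (altSeq_even h).symm⟩
      · obtain ⟨j, rfl⟩ : ∃ j, i = j + 1 := ⟨i - 1, by grind⟩
        exact ⟨j, by omega, (altSeq_even' hf (by grind)).symm⟩
    have hgS : ∀ w ∈ S, g w ∈ S := by
      intro w hw
      simp only [hS, Finset.mem_image, Finset.mem_range] at hw ⊢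
      obtain ⟨i, hi, rfl⟩ := hw
      rcases Nat.even_or_odd i with h | h
      · rcases Nat.eq_zero_or_pos i with rfl | hi0
        · refine ⟨3, by omega, ?_⟩
          rw [← hclose]
          exact (altSeq_odd' hg (by decide)).symm
        · obtain ⟨j, rfl⟩ : ∃ j, i = j + 1 := ⟨i - 1, by omega⟩
          exact ⟨j, by omega, (altSeq_odd' hg (by grind)).symm⟩
      · rcases (show i = 3 ∨ i + 1 < 4 by omega) with rfl | hi4
        · refine ⟨0, by omega, ?_⟩
          rw [← hclose]
          exact (altSeq_odd h).symm
        · exact ⟨i + 1, hi4, (altSeq_odd h).symm⟩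
    have hh := hf.piecewise hg S hfS hgS
    have hcard := hh.card_redVerts c
    have hcardf := hf.card_redVerts c
    have hle := card_redVerts_le c f (S.piecewise g f)
    have hsub : disagree f (S.piecewise g f) ⊆ S := by
      intro w hw
      by_contra hwS
      simp [mem_disagree, hwS] at hw
    have h4 : (disagree f (S.piecewise g f)).card ≤ 4 :=
      (Finset.card_le_card hsub).trans (Finset.card_image_le.trans (by simp))
    have hlt : (disagree (S.piecewise g f) g).card < (disagree f g).card := by
      refine Finset.card_lt_card ((Finset.ssubset_iff_of_subset fun w hw => ?_).2 ⟨v, hv, ?_⟩)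
      · by_cases hwS : w ∈ S
        · simp [mem_disagree, hwS] at hw
        · simpa [mem_disagree, hwS] using hw
      · have hvS : v ∈ S := Finset.mem_image.2 ⟨0, by simp, rfl⟩
        simp [mem_disagree, hvS]
    rcases le_or_gt (redVerts c (S.piecewise g f)).card (2 * k) with hk | hk
    · exact ih _ hlt hh hg hk hgk rfl
    · exact ⟨_, hh, .inr (by omega)⟩
  · obtain ⟨C, hC, hl, hs, he⟩ :=
      SimpleGraph.exists_cycle_of_seq (by omega) (altSeq_adj hf hg) hclose hinj
    obtain ⟨a, b, ha, hab, hbn, hlen, hodd, hadj⟩ := exists_chord_of_hasOddChord hclose hl hs he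
      (hchord _ C hC (by simp [hl]) (by omega))
    apply split
    rcases Nat.even_or_odd a with hae | hao
    · exact hf.exists_exchange_of_chord hg hinj hD (fun i hi => altSeq_even (by grind))
        (fun i hi => altSeq_odd (by grind)) ha hab hbn hlen hodd hadj
    · obtain ⟨h, hh, h1, h2⟩ := hg.exists_exchange_of_chord hf hinj
        (fun i => disagree_comm f g ▸ hD i) (fun i hi => altSeq_odd (by grind))
        (fun i hi => altSeq_even (by grind)) ha hab hbn hlen hodd hadj
      rw [disagree_comm g f] at h1 h2
      exact ⟨h, hh, by rwa [disagree_comm], by rwa [disagree_comm]⟩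

/-- if every even cycle of length at least 6 of `G` has an odd chord
(as in bipartite chordal and strongly chordal graphs), then `(G,c)` satisfies
Karzanov's weak property. -/
theorem stmt_16 (G : SimpleGraph V) (c : Sym2 V → Bool)
    (hchord : ∀ (v : V) (C : G.Walk v v), C.IsCycle → Even C.length → 6 ≤ C.length →
      HasOddChord C)
    (M M' : Finset (Sym2 V)) (hM : IsPM G M) (hM' : IsPM G M')
    (k : ℕ) (h1 : redCount c M ≤ k) (h2 : k ≤ redCount c M') :
    ∃ M'', IsPM G M'' ∧ (redCount c M'' = k ∨ redCount c M'' = k + 1) := by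
  obtain ⟨f, hf, rfl⟩ := hM.exists_partner
  obtain ⟨g, hg, rfl⟩ := hM'.exists_partner
  have hcf := hf.card_redVerts c
  have hcg := hg.card_redVerts c
  obtain ⟨h, hh, hk⟩ := hf.exists_card_redVerts c hchord k hg (by omega) (by omega)
  have hch := hh.card_redVerts c
  exact ⟨_, hh.isPM, by omega⟩
end
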